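/- Set n = #([s1,s2] ∩ ℤ), and assume that #([(n−1)s2, (n−1)s3] ∩ ℤ) = n and that n·s2 ∉ ℤ. Then for every positive integer d such that all vertices of the dilated triangle dΔ have integer coordinates, there exists a polynomial f ∈ ℚ[x,y] of total degree at most dw−1 such that f(p) = 0 for every lattice point p ∈ dΔ ∩ ℤ² with p ≠ (d·x1, d·y1), and f(d·x1, d·y1) ≠ 0. -/

import Mathlib

lemma aux_choose_prod (y : ℚ) (i : ℕ) :
    Ring.choose y i = (∏ j ∈ Finset.range i, (y - j)) / i.factorial := by
  have h := Ring.descPochhammer_eq_factorial_smul_choose y i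
  have h2 : (descPochhammer ℤ i).smeval y = ∏ j ∈ Finset.range i, (y - j) := by
    rw [← descPochhammer_eval_eq_prod_range, ← descPochhammer_map (Int.castRingHom ℚ) i,
      Polynomial.eval_map, Polynomial.eval₂_eq_sum, Polynomial.smeval_eq_sum]
    simp only [eq_intCast]
    refine Finset.sum_congr rfl fun e _ => ?_
    simp [Polynomial.smul_pow]
  rw [h2] at h
  have : (i.factorial : ℚ) ≠ 0 := by exact_mod_cast i.factorial_ne_zero
  rw [h]; field_simp; simp [mul_comm]

lemma aux_succ_mul (y : ℚ) (i : ℕ) :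
    ((i : ℚ) + 1) * Ring.choose y (i + 1) = y * Ring.choose (y - 1) i := by
  rw [aux_choose_prod, aux_choose_prod, Finset.prod_range_succ', Nat.factorial_succ]
  have : (i.factorial : ℚ) ≠ 0 := by exact_mod_cast i.factorial_ne_zero
  have h : ∀ j ∈ Finset.range i, y - ((j + 1 : ℕ) : ℚ) = y - 1 - j := by
    intro j _; push_cast; ring
  rw [Finset.prod_congr rfl h]
  push_cast
  field_simp
  simp [mul_comm]

lemma aux_vand (y c : ℚ) (n : ℕ) :
    ∑ i ∈ Finset.range (n + 1), Ring.choose y i * Ring.choose c (n - i)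
      = Ring.choose (y + c) n := by
  rw [Ring.add_choose_eq n (Commute.all y c),
    Finset.Nat.sum_antidiagonal_eq_sum_range_succ
      (fun i j => Ring.choose y i * Ring.choose c j)]

lemma aux_vand2 (y c : ℚ) (n : ℕ) :
    ∑ i ∈ Finset.range (n + 1 + 1), (i : ℚ) * (Ring.choose y i * Ring.choose c (n + 1 - i))
      = y * Ring.choose (y - 1 + c) n := by
  rw [Finset.sum_range_succ', ← aux_vand, Finset.mul_sum]
  simp only [Nat.cast_zero, zero_mul, add_zero]
  refine Finset.sum_congr rfl fun i _ => ?_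
  rw [← mul_assoc, ← mul_assoc, ← aux_succ_mul]
  push_cast
  simp

lemma aux_neg_one (n : ℕ) : Ring.choose (-1 : ℚ) n = (-1) ^ n := by
  induction n with
  | zero => simp
  | succ n ih =>
    have h := Ring.choose_succ_succ (-1 : ℚ) n
    rw [show (-1 : ℚ) + 1 = 0 by norm_num, Ring.choose_zero_succ, ih] at h
    rw [pow_succ]; linarith

lemma aux_neg_two (n : ℕ) : Ring.choose (-2 : ℚ) n = (-1) ^ n * (n + 1) := by
  induction n with
  | zero => simp
  | succ n ih =>
    have h := Ring.choose_succ_succ (-2 : ℚ) n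
    rw [show (-2 : ℚ) + 1 = -1 by norm_num, aux_neg_one, ih] at h
    rw [pow_succ] at *; push_cast; linarith

lemma aux_tele (m : ℚ) (i n : ℕ) (h : i ≤ n) :
    (∏ k ∈ Finset.Ico i n, (m - k)) * (m - n) = (m - i) * ∏ k ∈ Finset.Ico i n, (m - 1 - k) := by
  induction n, h using Nat.le_induction with
  | base => simp
  | succ n h ih =>
    rw [Finset.prod_Ico_succ_top h, Finset.prod_Ico_succ_top h, ih]
    push_cast; ring

/-- coefficient -/
noncomputable def auxCoef (m M : ℚ) (n i : ℕ) : ℚ :=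
  Ring.choose (M - 1) (n - i) / (i.factorial * ∏ k ∈ Finset.Ico i n, (m - 1 - k))

/-- interpolating function -/
noncomputable def auxG (m M : ℚ) (n : ℕ) (x y : ℚ) : ℚ :=
  ∑ i ∈ Finset.range (n + 1), auxCoef m M n i *
    ((∏ j ∈ Finset.range i, (y - j)) * ∏ k ∈ Finset.Ico i n, (x - k))

lemma aux_prod_ne (m n : ℕ) (h : n + 1 ≤ m) (i : ℕ) :
    (∏ k ∈ Finset.Ico i n, ((m : ℚ) - 1 - k)) ≠ 0 := by
  rw [Finset.prod_ne_zero_iff]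
  intro k hk
  have := (Finset.mem_Ico.1 hk).2
  have h2 : (k : ℚ) + 1 + 1 ≤ m := by exact_mod_cast (by omega : k + 1 + 1 ≤ m)
  intro h0; linarith

lemma auxG_col (m n : ℕ) (h : n + 1 ≤ m) (M y : ℚ) :
    auxG m M n (m - 1) y = Ring.choose (y + (M - 1)) n := by
  rw [← aux_vand, auxG]
  refine Finset.sum_congr rfl fun i _ => ?_
  have h1 := aux_prod_ne m n h i
  have : (i.factorial : ℚ) ≠ 0 := by exact_mod_cast i.factorial_ne_zero
  rw [auxCoef, aux_choose_prod y i]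
  field_simp

lemma auxG_vertex (m n : ℕ) (hn : 0 < n) (h : n + 1 ≤ m) (M : ℚ) (hM : (m : ℚ) - n * M ≠ 0) :
    auxG m M n m (-M) ≠ 0 := by
  have key : ((m : ℚ) - n) * auxG m M n m (-M) =
      ∑ i ∈ Finset.range (n + 1), ((m : ℚ) * (Ring.choose (-M) i * Ring.choose (M - 1) (n - i))
        - i * (Ring.choose (-M) i * Ring.choose (M - 1) (n - i))) := by
    rw [auxG, Finset.mul_sum]
    refine Finset.sum_congr rfl fun i hi => ?_
    have h1 := aux_prod_ne m n h i
    have : (i.factorial : ℚ) ≠ 0 := by exact_mod_cast i.factorial_ne_zero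
    have ht := aux_tele m i n (by have := Finset.mem_range.1 hi; omega)
    rw [auxCoef, aux_choose_prod (-M) i]
    have ht' : ((m : ℚ) - n) * ∏ k ∈ Finset.Ico i n, ((m : ℚ) - k) =
      (m - i) * ∏ k ∈ Finset.Ico i n, ((m : ℚ) - 1 - k) := by rw [mul_comm, ht]
    generalize (∏ k ∈ Finset.Ico i n, ((m : ℚ) - 1 - k)) = P at *
    generalize (∏ k ∈ Finset.Ico i n, ((m : ℚ) - k)) = Q at *
    generalize (∏ j ∈ Finset.range i, (-M - (j : ℚ))) = R at *
    field_simp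
    linear_combination Ring.choose (M - 1) (n - i) * R * ht'
  obtain ⟨n, rfl⟩ : ∃ k, n = k + 1 := ⟨n - 1, by omega⟩
  rw [Finset.sum_sub_distrib, ← Finset.mul_sum, aux_vand, aux_vand2,
    show -M + (M - 1) = -1 by ring, show -M - 1 + (M - 1) = -2 by ring, aux_neg_one,
    aux_neg_two] at key
  intro h0
  rw [h0, mul_zero] at key
  apply hM
  have h3 : (-1 : ℚ) ^ n ≠ 0 := pow_ne_zero _ (by norm_num)
  have : (-1 : ℚ) ^ n * ((m : ℚ) - (n + 1 : ℕ) * M) = 0 := by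
    push_cast; rw [pow_succ] at key; linarith
  exact (mul_eq_zero.1 this).resolve_left h3

lemma auxG_T (m M : ℚ) (n : ℕ) (x y : ℤ) (hx : x < n) (hy : 0 ≤ y) (hyx : y ≤ x) :
    auxG m M n x y = 0 := by
  lift y to ℕ using hy
  lift x to ℕ using (by omega)
  refine Finset.sum_eq_zero fun i _ => ?_
  rcases le_or_gt i x with h | h
  · rw [Finset.prod_eq_zero (i := x) (s := Finset.Ico i n) (Finset.mem_Ico.2 (by omega)) (by simp)]
    simp
  · rw [Finset.prod_eq_zero (i := y) (s := Finset.range i) (Finset.mem_range.2 (by omega)) (by simp)]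
    simp

section
open MvPolynomial

lemma aux_deg_lin (a b c : ℚ) :
    (C a + C b * X 0 + C c * X 1 : MvPolynomial (Fin 2) ℚ).totalDegree ≤ 1 := by
  refine (totalDegree_add _ _).trans (max_le ((totalDegree_add _ _).trans (max_le ?_ ?_)) ?_)
  · simp
  · refine (totalDegree_mul _ _).trans ?_; simp
  · refine (totalDegree_mul _ _).trans ?_; simp

lemma aux_deg_sub (P : MvPolynomial (Fin 2) ℚ) (h : P.totalDegree ≤ 1) (a : ℚ) :
    (P - C a).totalDegree ≤ 1 := by
  refine (totalDegree_sub _ _).trans (max_le h (by simp))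

lemma aux_deg_prod (P : MvPolynomial (Fin 2) ℚ) (h : P.totalDegree ≤ 1) (s : Finset ℕ) :
    (∏ k ∈ s, (P - C (k : ℚ))).totalDegree ≤ s.card := by
  refine (totalDegree_finsetProd _ _).trans ?_
  have h1 : ∀ i ∈ s, (P - C ((i : ℕ) : ℚ)).totalDegree ≤ 1 := fun i _ => aux_deg_sub P h _
  simpa using Finset.sum_le_sum h1

lemma aux_core (m n : ℕ) (hm0 : 0 < m) (s1 s2 s3 : ℚ)
    (hn : n = (Finset.Icc ⌈s1⌉ ⌊s2⌋).card)
    (hcount : (Finset.Icc ⌈((n : ℚ) - 1) * s2⌉ ⌊((n : ℚ) - 1) * s3⌋).card = n)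
    (hns2 : ∀ z : ℤ, (n : ℚ) * s2 ≠ (z : ℚ))
    (XR YR XL YL : ℤ) (hm : XR - XL = m) (hs2 : (m : ℚ) * s2 = YR - YL) :
    ∃ f : MvPolynomial (Fin 2) ℚ, f.totalDegree + 1 ≤ m ∧
      (∀ p : ℤ × ℤ, XL ≤ p.1 → p.1 ≤ XR →
        s2 * ((XR : ℚ) - p.1) ≤ YR - p.2 → (YR : ℚ) - p.2 ≤ s3 * ((XR : ℚ) - p.1) →
        s1 * ((p.1 : ℚ) - XL) ≤ p.2 - YL → ¬ (p.1 = XL ∧ p.2 = YL) →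
        eval ![(p.1 : ℚ), (p.2 : ℚ)] f = 0) ∧
      eval ![(XL : ℚ), (YL : ℚ)] f ≠ 0 := by
  have hn0 : 0 < n := by
    rcases Nat.eq_zero_or_pos n with h | h
    · exact absurd (by simp [h]) (hns2 0)
    · exact h
  set σ : ℤ := ⌈s2⌉ with hσ
  have hσ1 : s2 ≤ σ := Int.le_ceil _
  have hσ2 : (σ : ℚ) < s2 + 1 := Int.ceil_lt_add_one _
  have hσ3 : s2 < σ := by
    refine lt_of_le_of_ne hσ1 fun h => hns2 (n * σ) ?_
    push_cast; rw [← h]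
  have hmq : (XR : ℚ) - XL = m := by exact_mod_cast hm
  have hmpos : (0 : ℚ) < m := by exact_mod_cast hm0
  set M : ℤ := σ * m - (YR - YL) with hM
  have hMq : (M : ℚ) = m * (σ - s2) := by rw [hM]; push_cast; linarith
  have hMpos : (0 : ℚ) < M := by rw [hMq]; exact mul_pos hmpos (by linarith)
  have hM1 : 1 ≤ M := by exact_mod_cast hMpos
  have hMlt : M < m := by
    have : (M : ℚ) < m := by rw [hMq]; nlinarith
    exact_mod_cast this
  -- coordinates
  obtain ⟨Px, hPx, hPxd⟩ : ∃ P : MvPolynomial (Fin 2) ℚ,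
      (∀ a b : ℚ, eval ![a, b] P = XR - a) ∧ P.totalDegree ≤ 1 :=
    ⟨C (XR : ℚ) + C (-1) * X 0 + C 0 * X 1, by intro a b; simp; ring, aux_deg_lin _ _ _⟩
  obtain ⟨Py, hPy, hPyd⟩ : ∃ P : MvPolynomial (Fin 2) ℚ,
      (∀ a b : ℚ, eval ![a, b] P = YR - b - σ * (XR - a)) ∧ P.totalDegree ≤ 1 :=
    ⟨C (YR - σ * XR : ℚ) + C (σ : ℚ) * X 0 + C (-1) * X 1, by intro a b; simp; ring,
      aux_deg_lin _ _ _⟩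
  have hvx : (XR : ℚ) - XL = m := hmq
  have hvy : (YR : ℚ) - YL - σ * (XR - XL) = -M := by
    rw [hM, hmq]; push_cast; ring
  -- column m only holds the vertex
  have hvert : ∀ p : ℤ × ℤ, s2 * ((XR : ℚ) - p.1) ≤ YR - p.2 →
      s1 * ((p.1 : ℚ) - XL) ≤ p.2 - YL → p.1 = XL → p.2 = YL := by
    intro p h1 h2 h3
    rw [h3] at h1 h2
    rw [hmq, mul_comm, hs2] at h1
    have : (p.2 : ℚ) = YL := by linarith
    exact_mod_cast this
  rcases lt_or_ge s3 (σ + 1) with hcase | hcase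
  · -- case 1
    refine ⟨Py * ∏ k ∈ Finset.Ico 2 m, (Px - C (k : ℚ)), ?_, ?_, ?_⟩
    · have h1 := totalDegree_mul Py (∏ k ∈ Finset.Ico 2 m, (Px - C (k : ℚ)))
      have h2 := aux_deg_prod Px hPxd (Finset.Ico 2 m)
      rw [Nat.card_Ico] at h2
      omega
    · intro p hp1 hp2 h1 h2 h3 hne
      have hpx : p.1 ≠ XL := fun h => hne ⟨h, hvert p h1 h3 h⟩
      rw [map_mul, map_prod]
      obtain ⟨k, hk⟩ := Int.eq_ofNat_of_zero_le (sub_nonneg.2 hp2)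
      have hkq : (XR : ℚ) - p.1 = k := by exact_mod_cast hk
      by_cases hk2 : 2 ≤ k
      · rw [Finset.prod_eq_zero (i := k) (Finset.mem_Ico.2 ⟨hk2, by omega⟩)]
        · simp
        · simp [hPx, hkq]
      · have : Py.eval ![(p.1 : ℚ), (p.2 : ℚ)] = 0 := by
          rw [hPy]
          rw [hkq] at h1 h2 ⊢
          have hk3 : k = 0 ∨ k = 1 := by omega
          rcases hk3 with rfl | rfl
          · push_cast at *; linarith
          · push_cast at *
            have h4 : (-1 : ℚ) < ((YR - p.2 - σ : ℤ) : ℚ) := by push_cast; linarith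
            have h5 : ((YR - p.2 - σ : ℤ) : ℚ) < 1 := by push_cast; linarith
            have h4' : -1 < YR - p.2 - σ := by exact_mod_cast h4
            have h5' : YR - p.2 - σ < 1 := by exact_mod_cast h5
            have h6 : YR - p.2 - σ = 0 := by omega
            have h7 : ((YR - p.2 - σ : ℤ) : ℚ) = 0 := by rw [h6]; simp
            push_cast at h7; linarith
        rw [this, zero_mul]
    · rw [map_mul, map_prod, hPy, hvy]
      refine mul_ne_zero (by linarith) ?_
      rw [Finset.prod_ne_zero_iff]
      intro k hk
      have := (Finset.mem_Ico.1 hk).2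
      have h2 : (k : ℚ) < m := by exact_mod_cast this
      simp only [map_sub, hPx, eval_C, hvx]
      intro h0; linarith
  · -- case 2
    have hn1 : (1 : ℚ) ≤ n := by exact_mod_cast hn0
    have hA : ((n : ℤ) - 1) * (σ + 1) ≤ ⌊((n : ℚ) - 1) * s3⌋ := by
      rw [Int.le_floor]; push_cast
      exact mul_le_mul_of_nonneg_left hcase (by linarith)
    have hB : ⌈((n : ℚ) - 1) * s2⌉ ≤ ((n : ℤ) - 1) * σ := by
      rw [Int.ceil_le]; push_cast
      exact mul_le_mul_of_nonneg_left hσ1 (by linarith)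
    rw [Int.card_Icc] at hcount
    have hA' : ⌊((n : ℚ) - 1) * s3⌋ < ((n : ℤ) - 1) * (σ + 1) + 1 := by
      rw [mul_add] at *; omega
    have hB' : ((n : ℤ) - 1) * σ - 1 < ⌈((n : ℚ) - 1) * s2⌉ := by
      rw [mul_add] at *; omega
    rw [Int.floor_lt] at hA'
    rw [Int.lt_ceil] at hB'
    push_cast at hA' hB'
    have hfl : ⌊s2⌋ = σ - 1 := by
      rw [Int.floor_eq_iff]; push_cast; constructor <;> linarith
    have hmn : n + 1 ≤ m := by
      have h1 : n - 1 < m := by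
        by_contra hcon
        have : (m : ℚ) ≤ n - 1 := by
          have : m + 1 ≤ n := by omega
          have : (m : ℚ) + 1 ≤ n := by exact_mod_cast this
          linarith
        have h2 : (1 : ℚ) ≤ M := by exact_mod_cast hM1
        have h3 : (m : ℚ) * (σ - s2) ≤ (n - 1) * (σ - s2) :=
          mul_le_mul_of_nonneg_right this (by linarith)
        linarith
      have h2 : m ≠ n := by
        rintro rfl
        exact hns2 (YR - YL) (by push_cast; exact hs2)
      omega
    refine ⟨(∏ k ∈ Finset.Ico n (m - 1), (Px - C (k : ℚ))) *
      ∑ i ∈ Finset.range (n + 1), C (auxCoef m M n i) *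
        ((∏ j ∈ Finset.range i, (Py - C (j : ℚ))) * ∏ k ∈ Finset.Ico i n, (Px - C (k : ℚ))), ?_, ?_, ?_⟩
    · have h1 : (∑ i ∈ Finset.range (n + 1), C (auxCoef m M n i) *
        ((∏ j ∈ Finset.range i, (Py - C (j : ℚ))) *
          ∏ k ∈ Finset.Ico i n, (Px - C (k : ℚ)))).totalDegree ≤ n := by
        refine totalDegree_finsetSum_le fun i hi => ?_
        have hi' := Finset.mem_range.1 hi
        have e1 := aux_deg_prod Px hPxd (Finset.Ico i n)
        have e2 := aux_deg_prod Py hPyd (Finset.range i)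
        rw [Nat.card_Ico] at e1
        rw [Finset.card_range] at e2
        refine (totalDegree_mul _ _).trans ?_
        rw [totalDegree_C, zero_add]
        refine (totalDegree_mul _ _).trans ?_
        omega
      have h2 := aux_deg_prod Px hPxd (Finset.Ico n (m - 1))
      rw [Nat.card_Ico] at h2
      refine (Nat.add_le_add_right ((totalDegree_mul _ _).trans (Nat.add_le_add h2 h1)) 1).trans ?_
      omega
    · intro p hp1 hp2 h1 h2 h3 hne
      have hpx : p.1 ≠ XL := fun h => hne ⟨h, hvert p h1 h3 h⟩
      obtain ⟨k, hk⟩ := Int.eq_ofNat_of_zero_le (sub_nonneg.2 hp2)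
      have hkq : (XR : ℚ) - p.1 = k := by exact_mod_cast hk
      have hG : eval ![(p.1 : ℚ), (p.2 : ℚ)] (∑ i ∈ Finset.range (n + 1), C (auxCoef m M n i) *
          ((∏ j ∈ Finset.range i, (Py - C (j : ℚ))) * ∏ k ∈ Finset.Ico i n, (Px - C (k : ℚ))))
          = auxG m M n k (YR - p.2 - σ * k) := by
        simp [auxG, map_sum, map_prod, hPx, hPy, hkq]
      rw [map_mul, map_prod, hG]
      by_cases hkm : k = m - 1
      · have hkm' : (k : ℚ) = m - 1 := by
          rw [hkm]; push_cast [Nat.cast_sub (show 1 ≤ m by omega)]; ring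
        have hXL : p.1 - XL = 1 := by omega
        have hXLq : (p.1 : ℚ) - XL = 1 := by exact_mod_cast hXL
        rw [hkq, hkm'] at h1
        rw [hXLq] at h3
        have t1 : ⌈s1⌉ ≤ p.2 - YL := by rw [Int.ceil_le]; push_cast; linarith
        have t2 : p.2 - YL ≤ ⌊s2⌋ := by rw [Int.le_floor]; push_cast; linarith
        rw [Int.card_Icc] at hn
        obtain ⟨r, hr⟩ := Int.eq_ofNat_of_zero_le (sub_nonneg.2 t2)
        have hrn : r < n := by omega
        rw [hkm', auxG_col m n hmn]
        have : (YR : ℚ) - p.2 - σ * (m - 1) + (M - 1) = (r : ℚ) := by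
          have : (r : ℤ) = σ - 1 - (p.2 - YL) := by rw [← hfl]; exact hr.symm
          have h' : (r : ℚ) = σ - 1 - (p.2 - YL) := by exact_mod_cast this
          rw [h', hM]; push_cast; ring
        rw [this, Ring.choose_natCast, Nat.choose_eq_zero_of_lt hrn]
        simp
      · by_cases hkn : n ≤ k
        · rw [Finset.prod_eq_zero (i := k) (Finset.mem_Ico.2 ⟨hkn, by omega⟩)]
          · simp
          · simp [hPx, hkq]
        · have hk1 : (k : ℚ) ≤ n - 1 := by
            have : (k : ℚ) + 1 ≤ n := by exact_mod_cast (by omega : k + 1 ≤ n)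
            linarith
          rw [hkq] at h1 h2
          have q1 : (k : ℚ) * (σ - s2) ≤ (n - 1) * (σ - s2) :=
            mul_le_mul_of_nonneg_right hk1 (by linarith)
          have q2 : (k : ℚ) * (s3 - σ - 1) ≤ (n - 1) * (s3 - σ - 1) :=
            mul_le_mul_of_nonneg_right hk1 (by linarith)
          have y1 : (-1 : ℚ) < ((YR - p.2 - σ * k : ℤ) : ℚ) := by push_cast; linarith
          have y2 : ((YR - p.2 - σ * k : ℤ) : ℚ) < ((k + 1 : ℤ) : ℚ) := by push_cast; linarith
          have y1' : -1 < YR - p.2 - σ * k := by exact_mod_cast y1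
          have y2' : YR - p.2 - σ * k < k + 1 := by exact_mod_cast y2
          have := auxG_T m M n k (YR - p.2 - σ * k) (by omega) (by omega) (by omega)
          push_cast at this
          rw [this, mul_zero]
    · have hG : eval ![(XL : ℚ), (YL : ℚ)] (∑ i ∈ Finset.range (n + 1), C (auxCoef m M n i) *
          ((∏ j ∈ Finset.range i, (Py - C (j : ℚ))) * ∏ k ∈ Finset.Ico i n, (Px - C (k : ℚ))))
          = auxG m M n m (-M) := by
        rw [auxG, ← hvy]
        simp [map_sum, map_prod, hPx, hPy, hvx]
      rw [map_mul, map_prod, hG]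
      refine mul_ne_zero ?_ (auxG_vertex m n hn0 hmn M ?_)
      · rw [Finset.prod_ne_zero_iff]
        intro k hk
        have := (Finset.mem_Ico.1 hk).2
        have h2 : (k : ℚ) < m := by exact_mod_cast (by omega : k < m)
        simp only [map_sub, hPx, eval_C, hvx]
        intro h0; linarith
      · rw [hMq]
        intro h0
        have h1 : (m : ℚ) * (1 - n * (σ - s2)) = 0 := by linarith
        have h2 := (mul_eq_zero.1 h1).resolve_left hmpos.ne'
        exact hns2 (n * σ - 1) (by push_cast; linarith)

lemma aux_sorted {a b c s1 s2 s3 : ℚ} (hs : ({s1, s2, s3} : Set ℚ) = {a, b, c})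
    (h12 : s1 < s2) (h23 : s2 < s3) (hab : a < b) (hbc : b < c) : s1 = a ∧ s2 = b ∧ s3 = c := by
  have e1 : s1 ∈ ({a, b, c} : Set ℚ) := by rw [← hs]; simp
  have e2 : s2 ∈ ({a, b, c} : Set ℚ) := by rw [← hs]; simp
  have e3 : s3 ∈ ({a, b, c} : Set ℚ) := by rw [← hs]; simp
  simp only [Set.mem_insert_iff, Set.mem_singleton_iff] at e1 e2 e3
  rcases e1 with e1 | e1 | e1 <;> rcases e2 with e2 | e2 | e2 <;> rcases e3 with e3 | e3 | e3 <;>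
    first
    | exact ⟨e1, e2, e3⟩
    | (exfalso; linarith)

lemma aux_hull (a b c : ℚ) (P Q R p : ℚ × ℚ) (hP : c ≤ a * P.1 + b * P.2)
    (hQ : c ≤ a * Q.1 + b * Q.2) (hR : c ≤ a * R.1 + b * R.2)
    (hp : p ∈ convexHull ℚ ({P, Q, R} : Set (ℚ × ℚ))) : c ≤ a * p.1 + b * p.2 := by
  have hlin : IsLinearMap ℚ (fun v : ℚ × ℚ => a * v.1 + b * v.2) :=
    ⟨by intro x y; simp; ring, by intro x y; simp; ring⟩
  have := convexHull_min (s := ({P, Q, R} : Set (ℚ × ℚ))) ?_ (convex_halfSpace_ge hlin c) hp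
  · exact this
  · intro v hv
    simp only [Set.mem_insert_iff, Set.mem_singleton_iff] at hv
    rcases hv with rfl | rfl | rfl <;> assumption

lemma aux_main (L R : ℚ × ℚ) (hL : L.1 < 0) (hR : 0 < R.1)
    (t : ℚ) (ht : 0 < t) (ht1 : t < 1)
    (hx : 0 = (1 - t) * L.1 + t * R.1) (hy : 1 = (1 - t) * L.2 + t * R.2)
    (s1 s2 s3 : ℚ)
    (hs : ({s1, s2, s3} : Set ℚ) = {L.2 / L.1, (R.2 - L.2) / (R.1 - L.1), R.2 / R.1})
    (h12 : s1 < s2) (h23 : s2 < s3)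
    (n : ℕ) (hn : n = (Finset.Icc ⌈s1⌉ ⌊s2⌋).card)
    (hcount : (Finset.Icc ⌈((n : ℚ) - 1) * s2⌉ ⌊((n : ℚ) - 1) * s3⌋).card = n)
    (hns2 : ∀ z : ℤ, (n : ℚ) * s2 ≠ (z : ℚ))
    (d : ℕ) (hd : 0 < d)
    (hL1 : ∃ a : ℤ, (d : ℚ) * L.1 = a) (hL2 : ∃ a : ℤ, (d : ℚ) * L.2 = a)
    (hR1 : ∃ a : ℤ, (d : ℚ) * R.1 = a) (hR2 : ∃ a : ℤ, (d : ℚ) * R.2 = a) :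
    ∃ f : MvPolynomial (Fin 2) ℚ,
      ((f.totalDegree : ℚ) ≤ (d : ℚ) * (R.1 - L.1) - 1) ∧
      (∀ p : ℤ × ℤ,
        ((p.1 : ℚ), (p.2 : ℚ)) ∈
          convexHull ℚ ({(d : ℚ) • (0, 0), (d : ℚ) • L, (d : ℚ) • R} : Set (ℚ × ℚ)) →
        ((p.1 : ℚ), (p.2 : ℚ)) ≠ ((d : ℚ) * L.1, (d : ℚ) * L.2) →
        MvPolynomial.eval ![(p.1 : ℚ), (p.2 : ℚ)] f = 0) ∧
      MvPolynomial.eval ![(d : ℚ) * L.1, (d : ℚ) * L.2] f ≠ 0 := by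
  obtain ⟨xL, yL⟩ := L
  obtain ⟨xR, yR⟩ := R
  simp only at *
  have hdq : (0 : ℚ) < d := by exact_mod_cast hd
  have hwp : 0 < xR - xL := by linarith
  have hdet : xR * yL - xL * yR = xR - xL := by
    linear_combination (yR - yL) * hx - (xR - xL) * hy
  have hab : yL / xL < (yR - yL) / (xR - xL) := by
    rw [lt_div_iff₀ hwp, div_mul_eq_mul_div, div_lt_iff_of_neg hL]
    nlinarith
  have hbc : (yR - yL) / (xR - xL) < yR / xR := by
    rw [div_lt_div_iff₀ hwp hR]
    nlinarith
  obtain ⟨e1, e2, e3⟩ := aux_sorted hs h12 h23 hab hbc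
  have e1' : s1 * xL = yL := by rw [e1]; field_simp [hL.ne]
  have e2' : s2 * (xR - xL) = yR - yL := by rw [e2]; field_simp [hwp.ne']
  have e3' : s3 * xR = yR := by rw [e3]; field_simp [hR.ne']
  obtain ⟨XL, hXL⟩ := hL1
  obtain ⟨YL, hYL⟩ := hL2
  obtain ⟨XR, hXR⟩ := hR1
  obtain ⟨YR, hYR⟩ := hR2
  have hlt : XL < XR := by
    have : (XL : ℚ) < XR := by rw [← hXL, ← hXR]; exact mul_lt_mul_of_pos_left (by linarith) hdq
    exact_mod_cast this
  obtain ⟨m, hm⟩ := Int.eq_ofNat_of_zero_le (sub_nonneg.2 hlt.le)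
  have hmq : (XR : ℚ) - XL = m := by exact_mod_cast hm
  obtain ⟨f, hf1, hf2, hf3⟩ := aux_core m n (by omega) s1 s2 s3 hn hcount hns2 XR YR XL YL hm
    (by rw [← hmq, ← hXL, ← hXR, ← hYL, ← hYR]; linear_combination d * e2')
  refine ⟨f, ?_, ?_, ?_⟩
  · have : (f.totalDegree : ℚ) + 1 ≤ m := by exact_mod_cast hf1
    rw [mul_sub, hXL, hXR, hmq]; linarith
  · intro p hp hne
    rw [hXL, hYL] at hne
    -- top edge value at the origin
    have htop : s2 * xR - yR = -1 := by
      have : (xR - xL) * (s2 * xR - yR) = (xR - xL) * (-1) := by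
        linear_combination xR * e2' - hdet
      exact mul_left_cancel₀ hwp.ne' this
    have H := fun a b c h1 h2 h3 => aux_hull a b c _ _ _ _ h1 h2 h3 hp
    simp only [Prod.smul_mk, smul_eq_mul, mul_zero, hXL, hYL, hXR, hYR] at H
    have hYLq : s1 * (XL : ℚ) = YL := by rw [← hXL, ← hYL, ← e1']; ring
    have hYRq : s3 * (XR : ℚ) = YR := by rw [← hXR, ← hYR, ← e3']; ring
    have hTq : s2 * ((XR : ℚ) - XL) = YR - YL := by
      rw [← hXL, ← hXR, ← hYL, ← hYR]; linear_combination d * e2'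
    have hT0 : s2 * (XR : ℚ) - YR = -d := by
      rw [← hXR, ← hYR]; linear_combination d * htop
    have hXLn : (XL : ℚ) < 0 := by rw [← hXL]; exact mul_neg_of_pos_of_neg hdq hL
    have hXRp : (0 : ℚ) < XR := by rw [← hXR]; exact mul_pos hdq hR
    have hs1R : s1 * (XR : ℚ) ≤ YR := by
      rw [← hYRq]; exact mul_le_mul_of_nonneg_right (by linarith) hXRp.le
    have hs3L' : s3 * (XL : ℚ) ≤ YL := by
      rw [← hYLq]; exact mul_le_mul_of_nonpos_right (by linarith) hXLn.le
    refine hf2 p ?_ ?_ ?_ ?_ ?_ ?_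
    · have := H 1 0 XL (by linarith) (by linarith) (by linarith)
      have : (XL : ℚ) ≤ p.1 := by linarith
      exact_mod_cast this
    · have := H (-1) 0 (-XR) (by linarith) (by linarith) (by linarith)
      have : (p.1 : ℚ) ≤ XR := by linarith
      exact_mod_cast this
    · have := H s2 (-1) (s2 * XR - YR) (by linarith) (by linarith) (by linarith)
      linarith
    · have := H (-s3) 1 0 (by linarith) (by linarith) (by linarith)
      linarith
    · have := H (-s1) 1 0 (by linarith) (by linarith) (by linarith)
      linarith
    · rintro ⟨h1, h2⟩
      exact hne (by rw [h1, h2])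
  · rw [hXL, hYL]; exact hf3

end

/-- Gonzalez–Karu interpolation.  The triangle `Δ` is the convex
hull of the three non-collinear rational points `A = (0,0)`, `B`, `C`; no edge
is vertical (the `x`-coordinates of the vertices are pairwise distinct), the
point `(0,1)` lies in the relative interior of the edge `BC` (the edge not
containing `(0,0)`), `w` is the width of `Δ` and `w < 1`, `s1 < s2 < s3` are the
slopes of the three edges, `(x1,y1)` is the vertex of smallest `x`-coordinate,
`n = #([s1,s2] ∩ ℤ)`, `#([(n-1)s2,(n-1)s3] ∩ ℤ) = n`, and `n·s2 ∉ ℤ`.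
Then for every positive integer `d` such that all vertices of `dΔ` are integral
there is a polynomial `f` of total degree at most `dw - 1` vanishing at every
lattice point of `dΔ` other than `(d·x1, d·y1)`, and not vanishing at
`(d·x1, d·y1)`. -/
theorem interpolation_for_toric_surface
    (A B C : ℚ × ℚ)
    (hA : A = (0, 0))
    (hncol : (B.1 - A.1) * (C.2 - A.2) - (C.1 - A.1) * (B.2 - A.2) ≠ 0)
    (hAB : A.1 ≠ B.1) (hAC : A.1 ≠ C.1) (hBC : B.1 ≠ C.1)
    (hedge : ∃ t : ℚ, 0 < t ∧ t < 1 ∧ ((0 : ℚ), (1 : ℚ)) = (1 - t) • B + t • C)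
    (w : ℚ) (hw : w = max A.1 (max B.1 C.1) - min A.1 (min B.1 C.1))
    (hw1 : w < 1)
    (s1 s2 s3 : ℚ)
    (hs : ({s1, s2, s3} : Set ℚ) =
      {(B.2 - A.2) / (B.1 - A.1), (C.2 - A.2) / (C.1 - A.1), (C.2 - B.2) / (C.1 - B.1)})
    (h12 : s1 < s2) (h23 : s2 < s3)
    (x1 y1 : ℚ) (hv : ((x1, y1) : ℚ × ℚ) ∈ ({A, B, C} : Set (ℚ × ℚ)))
    (hx1 : x1 = min A.1 (min B.1 C.1))
    (n : ℕ) (hn : n = (Finset.Icc ⌈s1⌉ ⌊s2⌋).card)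
    (hcount : (Finset.Icc ⌈((n : ℚ) - 1) * s2⌉ ⌊((n : ℚ) - 1) * s3⌋).card = n)
    (hns2 : ∀ z : ℤ, (n : ℚ) * s2 ≠ (z : ℚ))
    (d : ℕ) (hd : 0 < d)
    (hint : ∀ v ∈ ({A, B, C} : Set (ℚ × ℚ)),
      (∃ a : ℤ, (d : ℚ) * v.1 = (a : ℚ)) ∧ (∃ b : ℤ, (d : ℚ) * v.2 = (b : ℚ))) :
    ∃ f : MvPolynomial (Fin 2) ℚ,
      ((f.totalDegree : ℚ) ≤ (d : ℚ) * w - 1) ∧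
      (∀ p : ℤ × ℤ,
        ((p.1 : ℚ), (p.2 : ℚ)) ∈
          convexHull ℚ ({(d : ℚ) • A, (d : ℚ) • B, (d : ℚ) • C} : Set (ℚ × ℚ)) →
        ((p.1 : ℚ), (p.2 : ℚ)) ≠ ((d : ℚ) * x1, (d : ℚ) * y1) →
        MvPolynomial.eval ![(p.1 : ℚ), (p.2 : ℚ)] f = 0) ∧
      MvPolynomial.eval ![(d : ℚ) * x1, (d : ℚ) * y1] f ≠ 0 := by
  subst hA
  obtain ⟨t, ht0, ht1, hte⟩ := hedge
  have hx : (0 : ℚ) = (1 - t) * B.1 + t * C.1 := by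
    have := congrArg Prod.fst hte; simpa using this
  have hy : (1 : ℚ) = (1 - t) * B.2 + t * C.2 := by
    have := congrArg Prod.snd hte; simpa using this
  simp only [sub_zero] at hs hAB hAC
  have hA := hint (0, 0) (by simp)
  have hB := hint B (by simp)
  have hC := hint C (by simp)
  have h1t : 0 < 1 - t := by linarith
  simp only [Set.mem_insert_iff, Set.mem_singleton_iff] at hv
  rcases lt_or_gt_of_ne hAB with hB0 | hB0
  · -- `C` is on the left
    have hC0 : C.1 < 0 := by
      have := mul_pos h1t hB0
      by_contra hcon
      have := mul_nonneg ht0.le (not_lt.1 hcon)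
      linarith
    have hmin : min (0 : ℚ) (min B.1 C.1) = C.1 := by
      rw [min_eq_right (by linarith : C.1 ≤ B.1), min_eq_right hC0.le]
    have hmax : max (0 : ℚ) (max B.1 C.1) = B.1 := by
      rw [max_eq_left (by linarith : C.1 ≤ B.1), max_eq_right hB0.le]
    simp only [hmin, hmax] at hw hx1
    have hvC : (x1, y1) = C := by
      rcases hv with h | h | h
      · have := congrArg Prod.fst h; simp only at this; exfalso; linarith
      · have := congrArg Prod.fst h; simp only at this; exfalso; linarith
      · exact h
    have hy1 : y1 = C.2 := congrArg Prod.snd hvC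
    have hset : ({s1, s2, s3} : Set ℚ) =
        {C.2 / C.1, (B.2 - C.2) / (B.1 - C.1), B.2 / B.1} := by
      rw [hs, show (C.2 - B.2) / (C.1 - B.1) = (B.2 - C.2) / (B.1 - C.1) by
        rw [← neg_sub B.2, ← neg_sub B.1, neg_div_neg_eq]]
      ext z; simp only [Set.mem_insert_iff, Set.mem_singleton_iff]; tauto
    have hset2 : ({(d : ℚ) • (0, 0), (d : ℚ) • B, (d : ℚ) • C} : Set (ℚ × ℚ)) =
        {(d : ℚ) • (0, 0), (d : ℚ) • C, (d : ℚ) • B} := by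
      rw [Set.pair_comm]
    rw [hw, hx1, hy1, hset2]
    exact aux_main C B hC0 hB0 (1 - t) h1t (by linarith) (by linarith) (by linarith) s1 s2 s3
      hset h12 h23 n hn hcount hns2 d hd hC.1 hC.2 hB.1 hB.2
  · have hC0 : 0 < C.1 := by
      have := mul_neg_of_pos_of_neg h1t hB0
      by_contra hcon
      have := mul_nonpos_of_nonneg_of_nonpos ht0.le (not_lt.1 hcon)
      linarith
    have hmin : min (0 : ℚ) (min B.1 C.1) = B.1 := by
      rw [min_eq_left (by linarith : B.1 ≤ C.1), min_eq_right hB0.le]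
    have hmax : max (0 : ℚ) (max B.1 C.1) = C.1 := by
      rw [max_eq_right (by linarith : B.1 ≤ C.1), max_eq_right hC0.le]
    simp only [hmin, hmax] at hw hx1
    have hvB : (x1, y1) = B := by
      rcases hv with h | h | h
      · have := congrArg Prod.fst h; simp only at this; exfalso; linarith
      · exact h
      · have := congrArg Prod.fst h; simp only at this; exfalso; linarith
    have hy1 : y1 = B.2 := congrArg Prod.snd hvB
    have hset : ({s1, s2, s3} : Set ℚ) =
        {B.2 / B.1, (C.2 - B.2) / (C.1 - B.1), C.2 / C.1} := by
      rw [hs]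
      ext z; simp only [Set.mem_insert_iff, Set.mem_singleton_iff]; tauto
    rw [hw, hx1, hy1]
    exact aux_main B C hB0 hC0 t ht0 ht1 hx hy s1 s2 s3
      hset h12 h23 n hn hcount hns2 d hd hB.1 hB.2 hC.1 hC.2
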